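/- Let p be a prime with p ≥ 3 and let F be an LR-separated cellular automaton over ZMod p with leftmost position ℓ and rightmost position r, so the local rule is f(x_1,…,x_{d+1}) = a_ℓ x_ℓ^{q_ℓ} + π(x_{ℓ+1},…,x_{r−1}) + a_r x_r^{q_r} with a_ℓ, a_r ≠ 0 and q_ℓ, q_r ≥ 1 (interpreted as f = a_ℓ x_ℓ^{q_ℓ} when ℓ = r). Then F is injective if and only if ℓ = r and gcd(q_ℓ, p−1) = 1. -/

import Mathlib

/-- The global map of the cellular automaton over `ZMod m` with diameter `d`
and local rule `f : (ZMod m)^{d+1} → ZMod m`: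
`F(x)_i = f(x_i, x_{i+1}, …, x_{i+d})`. -/
def globalMap (m d : ℕ) (f : (Fin (d + 1) → ZMod m) → ZMod m)
    (x : ℤ → ZMod m) : ℤ → ZMod m :=
  fun i => f fun k => x (i + ((k : ℕ) : ℤ))

/-- `f` is an `LR`-separated local rule with leftmost position `ℓ`, rightmost
position `r`, leftmost/rightmost coefficients `aℓ, ar` and exponents `qℓ, qr`:
either `ℓ = r` and `f(x) = aℓ * x_ℓ ^ qℓ`, or `ℓ < r` and
`f(x) = aℓ * x_ℓ ^ qℓ + π(x_{ℓ+1},…,x_{r-1}) + ar * x_r ^ qr` for some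
arbitrary map `π` of the `r - ℓ - 1` intermediate variables. -/
def LRSeparated (m d : ℕ) (f : (Fin (d + 1) → ZMod m) → ZMod m)
    (ℓ r : Fin (d + 1)) (aℓ ar : ZMod m) (qℓ qr : ℕ) : Prop :=
  aℓ ≠ 0 ∧ ar ≠ 0 ∧ 1 ≤ qℓ ∧ 1 ≤ qr ∧
    ((ℓ = r ∧ ∀ x, f x = aℓ * x ℓ ^ qℓ) ∨
      (ℓ < r ∧ ∃ π : ({i : Fin (d + 1) // ℓ < i ∧ i < r} → ZMod m) → ZMod m,
        ∀ x, f x = aℓ * x ℓ ^ qℓ + π (fun i => x i.1) + ar * x r ^ qr))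

open Polynomial in
/-- The only rational linear relations between the `p`-th roots of unity are the constant ones. -/
theorem eq_of_sum_mul_primitiveRoot_pow_eq_zero {p : ℕ} [Fact p.Prime] {ζ : ℂ}
    (hζ : IsPrimitiveRoot ζ p) (h : ZMod p → ℚ) (hsum : ∑ u, (h u : ℂ) * ζ ^ u.val = 0)
    (u v : ZMod p) : h u = h v := by
  have hp : p.Prime := Fact.out
  let P : ℚ[X] := ∑ u : ZMod p, C (h u) * X ^ u.val
  have hcoeff : ∀ u : ZMod p, P.coeff u.val = h u := by
    intro u
    simp only [P, finsetSum_coeff, coeff_C_mul, coeff_X_pow]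
    rw [Finset.sum_eq_single u] <;> simp +contextual [(ZMod.val_injective p).eq_iff, eq_comm]
  have hroot : aeval ζ P = 0 := by
    simp only [P, map_sum, map_mul, aeval_C, map_pow, aeval_X]
    simpa using hsum
  have hdvd : cyclotomic p ℚ ∣ P := by
    rw [cyclotomic_eq_minpoly_rat hζ hp.pos]
    exact minpoly.dvd _ _ hroot
  have hdeg : P.degree < p := by
    refine (degree_sum_le _ _).trans_lt ?_
    refine (Finset.sup_lt_iff (WithBot.bot_lt_coe p)).2 fun u _ => ?_
    refine (degree_C_mul_X_pow_le _ _).trans_lt ?_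
    exact Nat.cast_lt.2 (ZMod.val_lt u)
  obtain ⟨Q, hQ⟩ := hdvd
  obtain ⟨c, hc⟩ : ∃ c : ℚ, Q = C c := by
    by_cases hP : P = 0
    · refine ⟨0, ?_⟩
      rw [hP] at hQ
      simpa [cyclotomic_ne_zero] using hQ.symm
    · refine ⟨_, eq_C_of_natDegree_le_zero ?_⟩
      have hQ0 : Q ≠ 0 := by rintro rfl; simp [hP] at hQ
      have h1 := natDegree_mul (cyclotomic_ne_zero p ℚ) hQ0
      rw [← hQ, natDegree_cyclotomic, Nat.totient_prime hp] at h1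
      have h2 := (natDegree_lt_iff_degree_lt hP).2 hdeg
      have := hp.pos
      omega
  have key : ∀ u : ZMod p, h u = c := by
    intro u
    rw [← hcoeff u, hQ, hc, coeff_mul_C, cyclotomic_prime]
    simp [finsetSum_coeff, coeff_X_pow, ZMod.val_lt u]
  rw [key u, key v]

/-- If the convolution of `h` with the push-forward of the counting measure by a non-injective
map is constant, then `h` is constant. -/
theorem eq_of_sum_sub_const {p : ℕ} [Fact p.Prime] {g : ZMod p → ZMod p}
    (hg : ¬ Function.Injective g) (h : ZMod p → ℕ)
    (hconst : ∀ v v', ∑ c, h (v - g c) = ∑ c, h (v' - g c)) (u v : ZMod p) : h u = h v := by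
  have hp : p.Prime := Fact.out
  have hζ := Complex.isPrimitiveRoot_exp p hp.ne_zero
  set ζ := Complex.exp (2 * Real.pi * Complex.I / p)
  let χ : AddChar (ZMod p) ℂ := AddChar.zmodChar p hζ.pow_eq_one
  have hχ : ∀ u, χ u = ζ ^ u.val := fun u => AddChar.zmodChar_apply hζ.pow_eq_one u
  have hχ0 : ∑ v, χ v = 0 := by
    refine AddChar.sum_eq_zero_of_ne_one fun h1 => hζ.ne_one hp.one_lt ?_
    have : Fact (1 < p) := ⟨hp.one_lt⟩
    simpa [h1, ZMod.val_one] using (hχ 1).symm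
  have hprod : (∑ c, χ (g c)) * ∑ u, (h u : ℂ) * χ u = 0 := by
    calc (∑ c, χ (g c)) * ∑ u, (h u : ℂ) * χ u
        = ∑ c, ∑ v, (h (v - g c) : ℂ) * χ v := by
          rw [Finset.sum_mul]
          refine Finset.sum_congr rfl fun c _ => ?_
          rw [Finset.mul_sum, ← (Equiv.subRight (g c)).sum_comp]
          refine Finset.sum_congr rfl fun v _ => ?_
          have : χ v = χ (g c) * χ (v - g c) := by rw [← AddChar.map_add_eq_mul]; simp
          simp only [Equiv.subRight_apply, this]
          ring
      _ = ∑ v, ((∑ c, h (v - g c) : ℕ) : ℂ) * χ v := by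
          rw [Finset.sum_comm]
          simp [Finset.sum_mul]
      _ = 0 := by
          rw [Finset.sum_congr rfl fun v _ => by rw [hconst v 0], ← Finset.mul_sum, hχ0, mul_zero]
  rcases mul_eq_zero.1 hprod with h0 | h0
  · exfalso
    apply hg
    let D : ZMod p → ℕ := fun t => (Finset.univ.filter fun c => g c = t).card
    have hD : ∑ t, ((D t : ℚ) : ℂ) * ζ ^ t.val = 0 := by
      rw [← h0, ← Finset.sum_fiberwise Finset.univ g fun c => χ (g c)]
      refine Finset.sum_congr rfl fun t _ => ?_
      have : ∑ c ∈ Finset.univ.filter (fun c => g c = t), χ (g c) =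
          ∑ c ∈ Finset.univ.filter (fun c => g c = t), χ t :=
        Finset.sum_congr rfl fun c hc => by rw [(Finset.mem_filter.1 hc).2]
      rw [this]
      simp [D, hχ]
    have hDc := eq_of_sum_mul_primitiveRoot_pow_eq_zero hζ (fun t => (D t : ℚ)) hD
    have hsurj : Function.Surjective g := by
      intro t
      have hpos : 0 < D (g 0) := Finset.card_pos.2 ⟨0, by simp⟩
      have : D t = D (g 0) := by exact_mod_cast hDc t (g 0)
      obtain ⟨c, hc⟩ := Finset.card_pos.1 (this ▸ hpos)
      exact ⟨c, (Finset.mem_filter.1 hc).2⟩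
    exact Finite.injective_iff_surjective.2 hsurj
  · have := eq_of_sum_mul_primitiveRoot_pow_eq_zero hζ (fun t => (h t : ℚ))
      (by simpa [hχ] using h0) u v
    exact_mod_cast this

theorem pow_injective_iff_gcd_eq_one {p : ℕ} [Fact p.Prime] {q : ℕ} (hq : 1 ≤ q) :
    Function.Injective (fun x : ZMod p => x ^ q) ↔ Nat.gcd q (p - 1) = 1 := by
  have hcard : Nat.card (ZMod p)ˣ = p - 1 := by
    rw [Nat.card_eq_fintype_card, ZMod.card_units]
  have hker := IsCyclic.card_powMonoidHom_ker (ZMod p)ˣ q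
  rw [hcard] at hker
  have hcomm : Nat.gcd q (p - 1) = Nat.card (powMonoidHom q : (ZMod p)ˣ →* (ZMod p)ˣ).ker := by
    rw [hker, Nat.gcd_comm]
  rw [hcomm, Subgroup.card_eq_one, MonoidHom.ker_eq_bot_iff]
  constructor
  · intro h x y hxy
    apply Units.ext
    apply h
    simpa using congrArg Units.val hxy
  · intro h x y hxy
    have hq0 : q ≠ 0 := by omega
    simp only at hxy
    by_cases hx : x = 0
    · subst hx
      rw [zero_pow hq0] at hxy
      exact (pow_eq_zero_iff hq0).1 hxy.symm |>.symm
    by_cases hy : y = 0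
    · subst hy
      rw [zero_pow hq0] at hxy
      exact (pow_eq_zero_iff hq0).1 hxy
    have := @h (Units.mk0 x hx) (Units.mk0 y hy) (by ext; simpa using hxy)
    simpa using congrArg Units.val this

theorem globalMap_comp_add (m d : ℕ) (f : (Fin (d + 1) → ZMod m) → ZMod m)
    (x : ℤ → ZMod m) (i c : ℤ) :
    globalMap m d f (fun j => x (j + c)) i = globalMap m d f x (i + c) := by
  simp only [globalMap]
  congr 1
  funext k
  congr 1
  ring

theorem continuous_globalMap (m d : ℕ) (f : (Fin (d + 1) → ZMod m) → ZMod m) :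
    Continuous (globalMap m d f) := by
  refine continuous_pi fun i => ?_
  exact (continuous_of_discreteTopology (f := f)).comp
    (continuous_pi fun k => continuous_apply _)

/-- An injective cellular automaton has a local inverse. -/
theorem exists_radius_of_injective {m d : ℕ} [NeZero m] {f : (Fin (d + 1) → ZMod m) → ZMod m}
    (hinj : Function.Injective (globalMap m d f)) :
    ∃ K : ℕ, ∀ (c : ℤ) (x y : ℤ → ZMod m),
      (∀ i, c - K ≤ i → i ≤ c + K → globalMap m d f x i = globalMap m d f y i) → x c = y c := by
  set F := globalMap m d f with hF
  have hFc : Continuous F := continuous_globalMap m d f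
  suffices h : ∃ K : ℕ, ∀ x y : ℤ → ZMod m,
      (∀ i, -(K : ℤ) ≤ i → i ≤ K → F x i = F y i) → x 0 = y 0 by
    obtain ⟨K, hK⟩ := h
    refine ⟨K, fun c x y hxy => ?_⟩
    have := hK (fun j => x (j + c)) (fun j => y (j + c)) fun i h1 h2 => by
      rw [hF, globalMap_comp_add, globalMap_comp_add]
      exact hxy _ (by linarith) (by linarith)
    simpa using this
  by_contra! hcon
  let C : ℕ → Set ((ℤ → ZMod m) × (ℤ → ZMod m)) := fun K =>
    {z | z.1 0 ≠ z.2 0 ∧ ∀ i, -(K : ℤ) ≤ i → i ≤ K → F z.1 i = F z.2 i}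
  have hclosed : ∀ K, IsClosed (C K) := by
    intro K
    refine IsClosed.and ?_ ?_
    · have : Continuous fun z : (ℤ → ZMod m) × (ℤ → ZMod m) => (z.1 0, z.2 0) := by fun_prop
      exact (isClosed_discrete {w : ZMod m × ZMod m | w.1 ≠ w.2}).preimage this
    · simp only [Set.ofPred_forall]
      refine isClosed_iInter fun i => isClosed_iInter fun _ => isClosed_iInter fun _ => ?_
      exact isClosed_eq ((continuous_apply i).comp (hFc.comp continuous_fst))
        ((continuous_apply i).comp (hFc.comp continuous_snd))
  have : CompactSpace (ZMod m) := Finite.compactSpace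
  obtain ⟨z, hz⟩ := IsCompact.nonempty_iInter_of_sequence_nonempty_isCompact_isClosed C
    (fun K z hz => ⟨hz.1, fun i h1 h2 => hz.2 i (by push_cast; linarith) (by push_cast; linarith)⟩)
    (fun K => by
      obtain ⟨x, y, h1, h2⟩ := hcon K
      exact ⟨(x, y), h2, h1⟩)
    (hclosed 0).isCompact hclosed
  rw [Set.mem_iInter] at hz
  refine (hz 0).1 (congrFun (hinj (funext fun i => ?_)) 0)
  exact (hz i.natAbs).2 i (by omega) (by omega)

/-- The map `x ↦ (j ↦ g (x j) + S x j)`, where `S` is thought of as a sliding block code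
looking only to the right of the position `j`. -/
def addSlidingMap {p : ℕ} (g : ZMod p → ZMod p) (S : (ℤ → ZMod p) → ℤ → ZMod p)
    (x : ℤ → ZMod p) : ℤ → ZMod p :=
  fun j => g (x j) + S x j

/-- `S` commutes with translations, and `S x j` only depends on `x (j + 1), …, x (j + w)`. -/
structure IsRightSliding {p : ℕ} (w : ℕ) (S : (ℤ → ZMod p) → ℤ → ZMod p) : Prop where
  comp_add : ∀ x (j c : ℤ), S (fun i => x (i + c)) j = S x (j + c)
  congr : ∀ x y (j : ℤ), (∀ i, j < i → i ≤ j + w → x i = y i) → S x j = S y j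

section

variable {p : ℕ} {w : ℕ} {g : ZMod p → ZMod p} {S : (ℤ → ZMod p) → ℤ → ZMod p}

theorem IsRightSliding.addSlidingMap_comp_add (hS : IsRightSliding w S) (x : ℤ → ZMod p)
    (j c : ℤ) :
    addSlidingMap g S (fun i => x (i + c)) j = addSlidingMap g S x (j + c) := by
  simp only [addSlidingMap, hS.comp_add]

theorem IsRightSliding.addSlidingMap_congr (hS : IsRightSliding w S) {x y : ℤ → ZMod p} {j : ℤ}
    (h : ∀ i, j ≤ i → i ≤ j + w → x i = y i) : addSlidingMap g S x j = addSlidingMap g S y j := by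
  simp only [addSlidingMap]
  rw [h j le_rfl (by omega), hS.congr x y j fun i h1 h2 => h i h1.le h2]

theorem IsRightSliding.update (hS : IsRightSliding w S) (x : ℤ → ZMod p) {i j : ℤ} (hij : i ≤ j)
    (c : ZMod p) : S (Function.update x i c) j = S x j :=
  hS.congr _ _ _ fun k h1 _ => Function.update_of_ne (by omega) _ _

theorem IsRightSliding.addSlidingMap_update (hS : IsRightSliding w S) (x : ℤ → ZMod p) {i j : ℤ}
    (hij : i < j) (c : ZMod p) :
    addSlidingMap g S (Function.update x i c) j = addSlidingMap g S x j :=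
  hS.addSlidingMap_congr fun k h1 _ => Function.update_of_ne (by omega) _ _

theorem IsRightSliding.addSlidingMap_update_self (hS : IsRightSliding w S) (x : ℤ → ZMod p)
    (i : ℤ) (c : ZMod p) : addSlidingMap g S (Function.update x i c) i = g c + S x i := by
  simp only [addSlidingMap, Function.update_self, hS.update x le_rfl]

/-- An injective sliding map permutes the `N`-periodic configurations. -/
theorem IsRightSliding.exists_periodic_bijective [NeZero p] (hS : IsRightSliding w S)
    (hinj : Function.Injective (addSlidingMap g S)) (N : ℕ) [NeZero N] :
    ∃ T : (ZMod N → ZMod p) → ZMod N → ZMod p, Function.Bijective T ∧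
      ∀ x (j : ℤ), addSlidingMap g S (fun i => x (i : ZMod N)) j = T x (j : ZMod N) := by
  let T : (ZMod N → ZMod p) → ZMod N → ZMod p := fun x t =>
    addSlidingMap g S (fun i => x (i : ZMod N)) (t.cast : ℤ)
  have hT : ∀ x (j : ℤ), addSlidingMap g S (fun i => x (i : ZMod N)) j = T x (j : ZMod N) := by
    intro x j
    obtain ⟨k, hk⟩ : (N : ℤ) ∣ j - ((j : ZMod N).cast : ℤ) := by
      rw [← ZMod.intCast_zmod_eq_zero_iff_dvd]
      simp
    have hj : j = ((j : ZMod N).cast : ℤ) + N * k := by linarith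
    conv_lhs => rw [hj, ← hS.addSlidingMap_comp_add]
    simp [T]
  refine ⟨T, Finite.injective_iff_bijective.1 fun x y hxy => ?_, hT⟩
  have := hinj (a₁ := fun i => x (i : ZMod N)) (a₂ := fun i => y (i : ZMod N)) <| by
    funext j
    rw [hT, hT, hxy]
  funext t
  simpa using congrFun this (t.cast : ℤ)

theorem IsRightSliding.exists_eq_and_eqOn [Fact p.Prime] (hS : IsRightSliding w S)
    (hinj : Function.Injective (addSlidingMap g S)) (hg : ¬ Function.Injective g)
    (z : ℤ → ZMod p) (i : ℤ) (n : ℕ) (u : ZMod p) :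
    ∃ x, S x i = u ∧ ∀ j, i < j → j ≤ i + n → addSlidingMap g S x j = z j := by
  classical
  suffices h0 : ∀ z : ℤ → ZMod p,
      ∃ x, S x 0 = u ∧ ∀ j, 0 < j → j ≤ (n : ℤ) → addSlidingMap g S x j = z j by
    obtain ⟨x, hx, hxz⟩ := h0 fun j => z (j + i)
    refine ⟨fun j => x (j + -i), ?_, fun j h1 h2 => ?_⟩
    · rw [hS.comp_add, add_neg_cancel, hx]
    · rw [hS.addSlidingMap_comp_add, hxz _ (by linarith) (by linarith)]
      simp
  intro z
  let N := n + w + 1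
  have hNe : NeZero N := ⟨by omega⟩
  obtain ⟨T, hTbij, hT⟩ := hS.exists_periodic_bijective hinj N
  let ext : (ZMod N → ZMod p) → ℤ → ZMod p := fun x i => x (i : ZMod N)
  have hne : ∀ k : ℤ, 0 < k → k < N → (k : ZMod N) ≠ 0 := by
    intro k h1 h2 h3
    rw [ZMod.intCast_zmod_eq_zero_iff_dvd] at h3
    exact absurd (Int.le_of_dvd h1 h3) (by omega)
  have hupd : ∀ (x : ZMod N → ZMod p) c (k : ℤ), 0 < k → k < N →
      ext (Function.update x 0 c) k = ext x k := fun x c k h1 h2 =>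
    Function.update_of_ne (hne k h1 h2) _ _
  have hupdS : ∀ (x : ZMod N → ZMod p) c, S (ext (Function.update x 0 c)) 0 = S (ext x) 0 :=
    fun x c => hS.congr _ _ _ fun k h1 h2 => hupd x c k h1 (by omega)
  let good : Finset (ZMod N → ZMod p) := Finset.univ.filter fun x =>
    ∀ j : ℤ, 0 < j → j ≤ (n : ℤ) → addSlidingMap g S (ext x) j = z j
  have hgood : ∀ x, x ∈ good ↔
      ∀ j : ℤ, 0 < j → j ≤ (n : ℤ) → addSlidingMap g S (ext x) j = z j := by simp [good]
  have hgood_upd : ∀ x c, Function.update x 0 c ∈ good ↔ x ∈ good := by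
    intro x c
    rw [hgood, hgood]
    refine forall₃_congr fun j h1 h2 => ?_
    rw [hS.addSlidingMap_congr (x := ext (Function.update x 0 c)) (y := ext x)
      fun k h3 h4 => hupd x c k (by omega) (by omega)]
  let h : ZMod p → ℕ := fun u => (good.filter fun x => x 0 = 0 ∧ S (ext x) 0 = u).card
  let M : ZMod p → ℕ := fun v => (good.filter fun x => addSlidingMap g S (ext x) 0 = v).card
  have hM : ∀ v, M v = ∑ c, h (v - g c) := by
    intro v
    simp only [M]
    rw [Finset.card_eq_sum_card_fiberwise (f := fun x => x 0) (t := Finset.univ)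
      (fun _ _ => Finset.mem_coe.2 (Finset.mem_univ _))]
    refine Finset.sum_congr rfl fun c _ => ?_
    refine Finset.card_nbij' (fun x => Function.update x 0 0) (fun x => Function.update x 0 c)
      ?_ ?_ ?_ ?_
    · intro x hx
      simp only [Finset.coe_filter, Finset.mem_filter, Set.mem_ofPred_eq] at hx ⊢
      obtain ⟨⟨hx1, hx2⟩, hx3⟩ := hx
      refine ⟨(hgood_upd x 0).2 hx1, Function.update_self _ _ _, ?_⟩
      rw [hupdS, ← hx2, ← hx3]
      simp [addSlidingMap, ext]
    · intro x hx
      simp only [Finset.coe_filter, Finset.mem_filter, Set.mem_ofPred_eq] at hx ⊢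
      obtain ⟨hx1, hx2, hx3⟩ := hx
      refine ⟨⟨(hgood_upd x c).2 hx1, ?_⟩, Function.update_self _ _ _⟩
      simp only [addSlidingMap]
      rw [hupdS, hx3]
      simp [ext]
    · intro x hx
      simp only [Finset.coe_filter, Finset.mem_filter, Set.mem_ofPred_eq] at hx
      simp [← hx.2]
    · intro x hx
      simp only [Finset.coe_filter, Set.mem_ofPred_eq] at hx
      simp [← hx.2.1]
  have hTgood : ∀ x, x ∈ good ↔ ∀ j : ℤ, 0 < j → j ≤ (n : ℤ) → T x (j : ZMod N) = z j := by
    intro x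
    simp only [hgood, ext, hT]
  have hT0 : ∀ x, addSlidingMap g S (ext x) 0 = T x 0 := by
    intro x
    simpa using hT x 0
  have hMle : ∀ v v', M v ≤ M v' := by
    intro v v'
    let e := Equiv.ofBijective T hTbij
    have he : ∀ y, T (e.symm y) = y := e.apply_symm_apply
    refine Finset.card_le_card_of_injOn (fun x => e.symm (Function.update (T x) 0 v')) ?_ ?_
    · intro x hx
      simp only [Finset.coe_filter, Set.mem_ofPred_eq, hTgood, hT0] at hx ⊢
      rw [he]
      refine ⟨fun j h1 h2 => ?_, Function.update_self _ _ _⟩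
      rw [Function.update_of_ne (hne j h1 (by omega)), hx.1 j h1 h2]
    · intro x hx y hy hxy
      simp only [Finset.coe_filter, Set.mem_ofPred_eq, hT0] at hx hy
      have h1 := congrArg (fun t => Function.update t 0 v) (e.symm.injective hxy)
      simp only [Function.update_idem] at h1
      apply hTbij.1
      rw [← Function.update_eq_self 0 (T x), ← Function.update_eq_self 0 (T y), hx.2, hy.2, h1]
  have hhconst := eq_of_sum_sub_const hg h fun v v' => by
    rw [← hM, ← hM]; exact le_antisymm (hMle v v') (hMle v' v)
  obtain ⟨x₀, hx₀⟩ := hTbij.2 fun t => z t.val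
  have hx₀good : x₀ ∈ good := by
    rw [hTgood]
    intro j h1 h2
    rw [hx₀]
    lift j to ℕ using h1.le
    simp only [Int.cast_natCast]
    rw [ZMod.val_cast_of_lt (by omega)]
  have hpos : 0 < h (S (ext x₀) 0) := Finset.card_pos.2
    ⟨Function.update x₀ 0 0, Finset.mem_filter.2
      ⟨(hgood_upd _ _).2 hx₀good, Function.update_self _ _ _, hupdS _ _⟩⟩
  rw [hhconst _ u] at hpos
  obtain ⟨x, hx⟩ := Finset.card_pos.1 hpos
  rw [Finset.mem_filter] at hx
  exact ⟨ext x, hx.2.2, (hgood x).1 hx.1⟩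

/-- If `g` is not injective, two configurations with the same image on `[-n, K]` and distinct values
at `0` exist for every `n`, so a sliding map with a local inverse cannot be injective. -/
theorem IsRightSliding.not_injective_of_not_injective_left [Fact p.Prime]
    (hS : IsRightSliding w S) {K : ℕ}
    (hK : ∀ x y : ℤ → ZMod p, (∀ i : ℤ, -K ≤ i → i ≤ K →
      addSlidingMap g S x i = addSlidingMap g S y i) → x 0 = y 0)
    (hg : ¬ Function.Injective g) (hg01 : g 0 ≠ g 1) :
    ¬ Function.Injective (addSlidingMap g S) := by
  intro hinj
  set t := g 1 - g 0 with ht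
  have ht0 : t ≠ 0 := sub_ne_zero.2 hg01.symm
  suffices h : ∀ n : ℕ, ∃ x y : ℤ → ZMod p, x 0 ≠ y 0 ∧
      ∀ i : ℤ, -n ≤ i → i ≤ K → addSlidingMap g S x i = addSlidingMap g S y i by
    obtain ⟨x, y, hxy, h⟩ := h K
    exact hxy (hK x y h)
  have hstep : ∀ (x y : ℤ → ZMod p) (j : ℤ), S x j = S y j + t →
      addSlidingMap g S (Function.update x j 0) j =
        addSlidingMap g S (Function.update y j 1) j := by
    intro x y j h
    rw [hS.addSlidingMap_update_self, hS.addSlidingMap_update_self, h, ht]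
    ring
  intro n
  induction n with
  | zero =>
    obtain ⟨x, hx, hxz⟩ := hS.exists_eq_and_eqOn hinj hg 0 0 K t
    obtain ⟨y, hy, hyz⟩ := hS.exists_eq_and_eqOn hinj hg 0 0 K 0
    refine ⟨Function.update x 0 0, Function.update y 0 1, by simp, fun i h1 h2 => ?_⟩
    rcases eq_or_lt_of_le (show (0 : ℤ) ≤ i by simpa using h1) with rfl | h3
    · exact hstep x y 0 (by rw [hx, hy, zero_add])
    · rw [hS.addSlidingMap_update x h3, hS.addSlidingMap_update y h3, hxz i h3 (by omega),
        hyz i h3 (by omega)]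
  | succ n ih =>
    obtain ⟨x, y, hxy, h⟩ := ih
    let j : ℤ := -n - 1
    have hX : ∀ u, ∃ v, S v j = u ∧
        ∀ i : ℤ, j < i → i ≤ K → addSlidingMap g S v i = addSlidingMap g S x i := by
      intro u
      obtain ⟨v, hv, hvz⟩ := hS.exists_eq_and_eqOn hinj hg (addSlidingMap g S x) j (n + 1 + K) u
      exact ⟨v, hv, fun i h1 h2 => hvz i h1 (by push_cast; omega)⟩
    suffices hmain : ∃ u v, u 0 ≠ v 0 ∧ S u j = S v j + t ∧
        (∀ i : ℤ, j < i → i ≤ K → addSlidingMap g S u i = addSlidingMap g S x i) ∧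
        ∀ i : ℤ, j < i → i ≤ K → addSlidingMap g S v i = addSlidingMap g S x i by
      obtain ⟨u, v, huv, hSuv, hu, hv⟩ := hmain
      refine ⟨Function.update u j 0, Function.update v j 1, ?_, fun i h1 h2 => ?_⟩
      · rwa [Function.update_of_ne (by omega), Function.update_of_ne (by omega)]
      · rcases eq_or_lt_of_le (show j ≤ i by push_cast at h1; omega) with rfl | h3
        · exact hstep u v j hSuv
        · rw [hS.addSlidingMap_update u h3, hS.addSlidingMap_update v h3, hu i h3 h2,
            hv i h3 h2]
    choose X hXS hXH using hX
    by_contra! hcon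
    have hcon' : ∀ u v, S u j = S v j + t →
        (∀ i : ℤ, j < i → i ≤ K → addSlidingMap g S u i = addSlidingMap g S x i) →
        (∀ i : ℤ, j < i → i ≤ K → addSlidingMap g S v i = addSlidingMap g S x i) → u 0 = v 0 := by
      intro u v h1 h2 h3
      by_contra h4
      obtain ⟨i, hi1, hi2, hi3⟩ := hcon u v h4 h1 h2
      exact hi3 (h3 i hi1 hi2)
    have hXt : ∀ u, X (u + t) 0 = X u 0 := fun u =>
      hcon' _ _ (by rw [hXS, hXS]) (hXH _) (hXH _)
    have hXk : ∀ k : ℕ, X (k * t) 0 = X 0 0 := by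
      intro k
      induction k with
      | zero => simp
      | succ k ihk => rw [Nat.cast_succ, add_mul, one_mul, hXt, ihk]
    have hXc : ∀ u, X u 0 = X 0 0 := by
      intro u
      have := hXk (u / t).val
      rwa [ZMod.natCast_zmod_val, div_mul_cancel₀ _ ht0] at this
    have hall : ∀ v, (∀ i : ℤ, j < i → i ≤ K → addSlidingMap g S v i = addSlidingMap g S x i) →
        v 0 = X 0 0 := by
      intro v hv
      rw [← hcon' (X (S v j + t)) v (hXS _) (hXH _) hv, hXc]
    refine hxy ?_
    rw [hall x fun _ _ _ => rfl, hall y fun i h1 h2 => (h i (by omega) h2).symm]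

/-- If `g` is surjective, a nonzero configuration can be extended to the left so that its image is
that of `0`, without ever vanishing on `w` consecutive positions; this contradicts the existence of
a local inverse. -/
theorem IsRightSliding.false_of_surjective_left [NeZero p] (hS : IsRightSliding w S)
    (hp : 1 < p) (hw : 1 ≤ w) {K : ℕ}
    (hK : ∀ (c : ℤ) (x y : ℤ → ZMod p), (∀ i : ℤ, c - K ≤ i → i ≤ c + K →
      addSlidingMap g S x i = addSlidingMap g S y i) → x c = y c)
    (hg : Function.Surjective g)
    (hsep : ∀ (y : ℤ → ZMod p) (j : ℤ), (∀ i, j < i → i < j + w → y i = 0) → y (j + w) ≠ 0 →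
      S y j ≠ S 0 j) : False := by
  have : Fact (1 < p) := ⟨hp⟩
  have main : ∀ n : ℕ, ∃ y : ℤ → ZMod p,
      (∀ i : ℤ, -n ≤ i → i < 0 → addSlidingMap g S y i = addSlidingMap g S 0 i) ∧
      ∀ m : ℤ, -n ≤ m → m ≤ 0 → ∃ i, m ≤ i ∧ i < m + w ∧ y i ≠ 0 := by
    intro n
    induction n with
    | zero =>
      refine ⟨fun _ => 1, fun i h1 h2 => by simp at h1; omega, fun m h1 h2 => ⟨m, le_rfl, ?_, ?_⟩⟩
      · omega
      · exact one_ne_zero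
    | succ n ih =>
      obtain ⟨y, hy, hyw⟩ := ih
      let j : ℤ := -n - 1
      obtain ⟨c, hc⟩ := hg (g 0 + S 0 j - S y j)
      have hyj : addSlidingMap g S (Function.update y j c) j = addSlidingMap g S 0 j := by
        rw [hS.addSlidingMap_update_self, hc]
        simp [addSlidingMap]
      refine ⟨Function.update y j c, fun i h1 h2 => ?_, fun m h1 h2 => ?_⟩
      · rcases eq_or_lt_of_le (show j ≤ i by push_cast at h1; omega) with rfl | h3
        · exact hyj
        · rw [hS.addSlidingMap_update y h3, hy i (by omega) h2]
      · rcases eq_or_lt_of_le (show j ≤ m by push_cast at h1; omega) with rfl | h3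
        · by_contra! hcon
          have hz : ∀ i, j < i → i < j + w → y i = 0 := fun i h3 h4 => by
            simpa [Function.update_of_ne h3.ne'] using hcon i h3.le h4
          have hc0 : c = 0 := by simpa using hcon j le_rfl (by omega)
          obtain ⟨i, hi1, hi2, hi3⟩ := hyw (-n) le_rfl (by omega)
          have hij : i = j + w := by
            by_contra hne
            exact hi3 (hz i (by omega) (by omega))
          refine hsep y j hz (hij ▸ hi3) ?_
          rw [hc0] at hc
          linear_combination hc
        · obtain ⟨i, hi1, hi2, hi3⟩ := hyw m (by omega) h2
          exact ⟨i, hi1, hi2, by rwa [Function.update_of_ne (by omega)]⟩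
  obtain ⟨y, hy, hyw⟩ := main (w + K + K)
  obtain ⟨i, hi1, hi2, hi3⟩ := hyw (-(w + K : ℕ)) (by push_cast; omega) (by omega)
  refine hi3 (hK i y 0 fun k h1 h2 => hy k ?_ ?_) <;> push_cast at * <;> omega

end

/-- When `ℓ < r`, an `LR`-separated cellular automaton is never injective. -/
theorem not_injective_globalMap_of_lt {p : ℕ} [Fact p.Prime] {d : ℕ}
    {f : (Fin (d + 1) → ZMod p) → ZMod p} {ℓ r : Fin (d + 1)} {aℓ ar : ZMod p} {qℓ qr : ℕ}
    (haℓ : aℓ ≠ 0) (har : ar ≠ 0) (hqℓ : 1 ≤ qℓ) (hqr : 1 ≤ qr) (hlr : ℓ < r)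
    {π : ({i : Fin (d + 1) // ℓ < i ∧ i < r} → ZMod p) → ZMod p}
    (hf : ∀ x, f x = aℓ * x ℓ ^ qℓ + π (fun i => x i.1) + ar * x r ^ qr) :
    ¬ Function.Injective (globalMap p d f) := by
  intro hinj
  obtain ⟨K, hK⟩ := exists_radius_of_injective hinj
  have hlr' : (ℓ : ℕ) < r := hlr
  let w : ℕ := r - ℓ
  have hw : (w : ℤ) = (r : ℕ) - (ℓ : ℕ) := by simp only [w]; omega
  let g : ZMod p → ZMod p := fun c => aℓ * c ^ qℓ
  let S : (ℤ → ZMod p) → ℤ → ZMod p := fun x j =>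
    π (fun i => x (j + (((i.1 : ℕ) : ℤ) - (ℓ : ℕ)))) + ar * x (j + w) ^ qr
  have hS : IsRightSliding w S := by
    refine ⟨fun x j c => ?_, fun x y j h => ?_⟩
    · simp only [S, add_right_comm j _ c]
    · simp only [S]
      rw [h (j + w) (by omega) le_rfl]
      congr 2
      funext i
      have h1 : (ℓ : ℕ) < (i.1 : ℕ) := i.2.1
      have h2 : (i.1 : ℕ) < (r : ℕ) := i.2.2
      exact h _ (by omega) (by omega)
  have hHF : ∀ x j, addSlidingMap g S x j = globalMap p d f x (j - (ℓ : ℕ)) := by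
    intro x j
    have e : ∀ k : ℤ, j + (k - (ℓ : ℕ)) = j - (ℓ : ℕ) + k := fun k => by ring
    simp only [addSlidingMap, globalMap, hf, g, S, hw, e, sub_add_cancel]
    ring
  have hKH : ∀ (c : ℤ) (x y : ℤ → ZMod p), (∀ i : ℤ, c - (K + ℓ : ℕ) ≤ i → i ≤ c + (K + ℓ : ℕ) →
      addSlidingMap g S x i = addSlidingMap g S y i) → x c = y c := by
    intro c x y h
    refine hK c x y fun i h1 h2 => ?_
    have := h (i + (ℓ : ℕ)) (by push_cast; omega) (by push_cast; omega)
    rwa [hHF, hHF, add_sub_cancel_right] at this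
  by_cases hg : Function.Injective g
  · refine hS.false_of_surjective_left (Fact.out : p.Prime).one_lt (by omega) hKH
      (Finite.injective_iff_surjective.1 hg) fun y j hz hne heq => ?_
    have hπ : (fun i : {i : Fin (d + 1) // ℓ < i ∧ i < r} =>
        y (j + (((i.1 : ℕ) : ℤ) - (ℓ : ℕ)))) = fun _ => 0 := by
      funext i
      have h1 : (ℓ : ℕ) < (i.1 : ℕ) := i.2.1
      have h2 : (i.1 : ℕ) < (r : ℕ) := i.2.2
      exact hz _ (by omega) (by omega)
    simp only [S, hπ, Pi.zero_apply, add_right_inj, zero_pow (show qr ≠ 0 by omega),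
      mul_zero] at heq
    exact mul_ne_zero har (pow_ne_zero _ hne) heq
  · refine hS.not_injective_of_not_injective_left (K := K + ℓ)
      (fun x y h => hKH 0 x y (by simpa using h)) hg ?_ fun x y h => ?_
    · simpa [g, show qℓ ≠ 0 by omega] using haℓ.symm
    · refine hinj (funext fun i => ?_)
      have := congrFun h (i + (ℓ : ℕ))
      rwa [hHF, hHF, add_sub_cancel_right] at this

/-- Let `p ≥ 3` be prime and `F` an `LR`-separated CA over `ZMod p` with
leftmost position `ℓ` and rightmost position `r`.  Then `F` is injective iff
`ℓ = r` and `gcd(qℓ, p - 1) = 1`. -/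
theorem LRseparated_injective_iff
    (p : ℕ) (hp : p.Prime) (hp3 : 3 ≤ p) (d : ℕ)
    (f : (Fin (d + 1) → ZMod p) → ZMod p)
    (ℓ r : Fin (d + 1)) (aℓ ar : ZMod p) (qℓ qr : ℕ)
    (hsep : LRSeparated p d f ℓ r aℓ ar qℓ qr) :
    Function.Injective (globalMap p d f) ↔
      ℓ = r ∧ Nat.gcd qℓ (p - 1) = 1 := by
  have : Fact p.Prime := ⟨hp⟩
  obtain ⟨haℓ, har, hqℓ, hqr, ⟨rfl, hf⟩ | ⟨hlr, π, hf⟩⟩ := hsep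
  · rw [← pow_injective_iff_gcd_eq_one hqℓ]
    simp only [true_and]
    constructor
    · intro hinj a b hab
      have : (fun _ : ℤ => a) = fun _ => b := hinj <| by
        funext i
        simpa [globalMap, hf] using Or.inl hab
      exact congrFun this 0
    · intro hinj x y hxy
      funext j
      have h := congrFun hxy (j - (ℓ : ℕ))
      simp only [globalMap, hf, sub_add_cancel] at h
      exact hinj (mul_left_cancel₀ haℓ h)
  · exact iff_of_false (not_injective_globalMap_of_lt haℓ har hqℓ hqr hlr hf)
      fun h => hlr.ne h.1
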